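/- For a connected weighted graph G and an edge e with weight w_e, 1 − 𝒯(G∖{e})/𝒯(G) = w_e · b(e)ᵀ L(G)† b(e), where 𝒯 denotes total spanning tree weight. -/

import Mathlib

open Matrix Finset

/-- Connectivity of `V` using only the edges in the set `S`. -/
def EdgeConn {V E : Type*} (ends : E → V × V) (S : Finset E) : Prop :=
  ∀ a b : V, Relation.ReflTransGen
    (fun x y => ∃ e ∈ S, ends e = (x, y) ∨ ends e = (y, x)) a b

/-- A set `T` of edges is a spanning tree: it connects all vertices and has `|V| - 1` edges. -/
def IsSpanningTree {V E : Type*} [Fintype V] (ends : E → V × V) (T : Finset E) : Prop :=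
  EdgeConn ends T ∧ T.card + 1 = Fintype.card V

open Classical in
/-- The total spanning tree weight `𝒯` of the weighted multigraph `(V, S, w)`, i.e. the sum
over all spanning trees `T ⊆ S` of `∏_{e ∈ T} w e`. -/
noncomputable def treeWeight {V E : Type*} [Fintype V] [Fintype E] (ends : E → V × V)
    (w : E → ℝ) (S : Finset E) : ℝ :=
  ∑ T : Finset E, if T ⊆ S ∧ IsSpanningTree ends T then ∏ e ∈ T, w e else 0

/-- The signed incidence vector of an edge `e`. -/
noncomputable def inc {V E : Type*} [DecidableEq V] (ends : E → V × V) (e : E) : V → ℝ :=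
  fun v => (if v = (ends e).1 then 1 else 0) - (if v = (ends e).2 then 1 else 0)

/-- The weighted graph Laplacian `L = ∑ₑ wₑ b(e) b(e)ᵀ`. -/
noncomputable def lap {V E : Type*} [Fintype V] [Fintype E] [DecidableEq V]
    (ends : E → V × V) (w : E → ℝ) : Matrix V V ℝ :=
  ∑ e : E, w e • vecMulVec (inc ends e) (inc ends e)

section CauchyBinet

variable {n ι R : Type*} [Fintype n] [DecidableEq n] [Fintype ι] [CommRing R]

/-- Expansion of the determinant of a sum of rank one matrices by multilinearity in the rows. -/
theorem det_sum_smul_vecMulVec_eq_sum_fun (c : ι → R) (u : ι → n → R) :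
    (∑ k, c k • vecMulVec (u k) (u k)).det =
      ∑ f : n → ι, (∏ i, c (f i) * u (f i) i) * (of fun i => u (f i)).det := by
  have h : (∑ k, c k • vecMulVec (u k) (u k)) = fun i => ∑ k, (c k * u k i) • u k := by
    ext i j
    simp [Matrix.sum_apply, vecMulVec_apply, Finset.sum_apply, mul_assoc]
  rw [h]
  refine ((detRowAlternating (R := R) (n := n)).toMultilinearMap.map_sum _).trans ?_
  refine Finset.sum_congr rfl fun f _ => ?_
  exact (detRowAlternating (R := R) (n := n)).toMultilinearMap.map_smul_univ _ _

variable [DecidableEq ι]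

theorem sum_fun_image_eq (c : ι → R) (u : ι → n → R) {g : n → ι} (hg : g.Injective) :
    ∑ f : n → ι with univ.image f = univ.image g,
        (∏ i, c (f i) * u (f i) i) * (of fun i => u (f i)).det =
      (∏ k ∈ univ.image g, c k) * (of fun i => u (g i)).det ^ 2 := by
  have hbij : ∑ f : n → ι with univ.image f = univ.image g,
        (∏ i, c (f i) * u (f i) i) * (of fun i => u (f i)).det =
      ∑ σ : Equiv.Perm n,
        (∏ i, c (g (σ i)) * u (g (σ i)) i) * (of fun i => u (g (σ i))).det := by
    symm
    refine Finset.sum_bij (fun σ _ => g ∘ σ) ?_ ?_ ?_ ?_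
    · intro σ _
      simp only [mem_filter, mem_univ, true_and]
      rw [← Finset.image_image, Finset.image_univ_equiv]
    · intro σ _ τ _ h
      exact Equiv.ext fun i => hg (congrFun h i)
    · intro f hf
      have hf' : univ.image f = univ.image g := (mem_filter.1 hf).2
      have hinj : f.Injective := by
        rw [← Set.injOn_univ, ← Finset.coe_univ, ← Finset.card_image_iff, hf',
          Finset.card_image_of_injective _ hg]
      have hex : ∀ i, ∃ j, g j = f i := fun i => by
        have : f i ∈ univ.image g := hf' ▸ mem_image_of_mem f (mem_univ i)
        simpa using this
      choose s hs using hex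
      have hsinj : s.Injective := fun i j hij => hinj (by rw [← hs i, ← hs j, hij])
      exact ⟨Equiv.ofBijective s (Finite.injective_iff_bijective.1 hsinj), mem_univ _,
        funext hs⟩
    · intro σ _
      rfl
  rw [hbij, Finset.prod_image fun i _ j _ h => hg h, sq]
  have hterm : ∀ σ : Equiv.Perm n,
      (∏ i, c (g (σ i)) * u (g (σ i)) i) * (of fun i => u (g (σ i))).det =
        (∏ i, c (g i)) * (of fun i => u (g i)).det *
          (((Equiv.Perm.sign σ : ℤ) : R) * ∏ i, (of fun i => u (g i)) (σ i) i) := by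
    intro σ
    have := det_permute σ (of fun i => u (g i))
    have h2 : (of fun i => u (g (σ i))) = (of fun i => u (g i)).submatrix σ id := rfl
    rw [h2, this, Finset.prod_mul_distrib, σ.prod_comp univ (fun i => c (g i)) (by simp)]
    simp only [of_apply]
    ring
  rw [Finset.sum_congr rfl fun σ _ => hterm σ, ← Finset.mul_sum, ← det_apply']
  ring

/-- The Cauchy-Binet formula for a weighted Gram matrix: `d S` is the common value of the squares
of the maximal minors with rows `S`. -/
theorem det_sum_smul_vecMulVec (c : ι → R) (u : ι → n → R) (d : Finset ι → R)
    (hd : ∀ g : n → ι, g.Injective → (of fun i => u (g i)).det ^ 2 = d (univ.image g))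
    (hd0 : ∀ S, S.card ≠ Fintype.card n → d S = 0) :
    (∑ k, c k • vecMulVec (u k) (u k)).det = ∑ S : Finset ι, (∏ k ∈ S, c k) * d S := by
  rw [det_sum_smul_vecMulVec_eq_sum_fun,
    ← Finset.sum_fiberwise univ (fun f : n → ι => univ.image f)]
  refine Finset.sum_congr rfl fun S _ => ?_
  by_cases hS : S.card = Fintype.card n
  · let e : n ≃ S := Fintype.equivOfCardEq (by simp [hS])
    have hg : (fun i => (e i : ι)).Injective := Subtype.val_injective.comp e.injective
    have himg : univ.image (fun i => (e i : ι)) = S := by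
      refine Finset.eq_of_subset_of_card_le ?_ ?_
      · intro k hk
        obtain ⟨i, -, rfl⟩ := mem_image.1 hk
        exact (e i).2
      · rw [Finset.card_image_of_injective _ hg, hS, Finset.card_univ]
    have := sum_fun_image_eq c u hg
    rw [hd _ hg, himg] at this
    exact this
  · rw [hd0 S hS, mul_zero]
    refine Finset.sum_eq_zero fun f hf => ?_
    have hf' : univ.image f = S := (mem_filter.1 hf).2
    have hinj : ¬ f.Injective := fun h => hS (by
      rw [← hf', Finset.card_image_of_injective _ h, Finset.card_univ])
    obtain ⟨i, j, hij, hne⟩ := Function.not_injective_iff.1 hinj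
    rw [det_zero_of_row_eq hne (congrArg u hij), mul_zero]

end CauchyBinet

section MatrixTree

theorem treeWeight_update_zero {V E : Type*} [Fintype V] [Fintype E] [DecidableEq E]
    (ends : E → V × V) (w : E → ℝ) (e : E) :
    treeWeight ends (Function.update w e 0) univ = treeWeight ends w (univ.erase e) := by
  classical
  refine Finset.sum_congr rfl fun T _ => ?_
  by_cases he : e ∈ T
  · have h1 : ¬ T ⊆ univ.erase e := fun h => by simpa using h he
    simp [h1, Finset.prod_eq_zero he]
  · have h1 : T ⊆ univ.erase e := fun a ha => by
      simpa using ne_of_mem_of_not_mem ha he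
    have h2 : ∏ a ∈ T, Function.update w e 0 a = ∏ a ∈ T, w a :=
      Finset.prod_congr rfl fun a ha => Function.update_of_ne (ne_of_mem_of_not_mem ha he) _ _
    simp [h1, h2]

variable {V E : Type*} [DecidableEq V]

/-- The rows of the incidence matrix, together with the indicator of a root vertex `r`. -/
def rootedInc (R : Type*) [Ring R] (ends : E → V × V) (r : V) : Option E → V → R
  | none => Pi.single r 1
  | some e => Pi.single (ends e).1 1 - Pi.single (ends e).2 1

theorem rootedInc_some (ends : E → V × V) (r : V) (e : E) :
    rootedInc ℝ ends r (some e) = inc ends e := by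
  ext v
  simp [rootedInc, inc, Pi.single_apply]

theorem intCast_rootedInc (R : Type*) [Ring R] (ends : E → V × V) (r : V) (o : Option E) (v : V) :
    ((rootedInc ℤ ends r o v : ℤ) : R) = rootedInc R ends r o v := by
  cases o <;> simp [rootedInc, Pi.single_apply, apply_ite (Int.cast (R := R))]

variable [Fintype V]

theorem rootedInc_none_dotProduct {R : Type*} [Ring R] (ends : E → V × V) (r : V) (x : V → R) :
    rootedInc R ends r none ⬝ᵥ x = x r := by
  simp [rootedInc]

theorem rootedInc_some_dotProduct {R : Type*} [Ring R] (ends : E → V × V) (r : V) (e : E)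
    (x : V → R) :
    rootedInc R ends r (some e) ⬝ᵥ x = x (ends e).1 - x (ends e).2 := by
  simp [rootedInc, sub_dotProduct]

theorem inc_dotProduct (ends : E → V × V) (e : E) (x : V → ℝ) :
    inc ends e ⬝ᵥ x = x (ends e).1 - x (ends e).2 := by
  rw [← rootedInc_some ends (ends e).1, rootedInc_some_dotProduct]

theorem det_rootedInc_sq_eq_one [DecidableEq E] (ends : E → V × V) (r : V) (g : V → Option E)
    (hr : none ∈ univ.image g) (hc : EdgeConn ends (eraseNone (univ.image g))) :
    (of fun i => rootedInc ℤ ends r (g i)).det ^ 2 = 1 := by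
  set N : Matrix V V ℤ := of fun i => rootedInc ℤ ends r (g i) with hN
  have hrow : ∀ o ∈ univ.image g, rootedInc ℤ ends r o ∈ LinearMap.range N.vecMulLinear := by
    intro o ho
    obtain ⟨i, -, rfl⟩ := mem_image.1 ho
    exact ⟨Pi.single i 1, by ext j; simp [hN]⟩
  have hsingle : ∀ v, (Pi.single v 1 : V → ℤ) ∈ LinearMap.range N.vecMulLinear := by
    intro v
    induction hc r v with
    | refl => exact hrow none hr
    | tail _ hstep ih =>
      obtain ⟨e, he, h⟩ := hstep
      have hmem := hrow (some e) (mem_eraseNone.1 he)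
      rcases h with h | h
      · have := Submodule.sub_mem _ ih hmem
        simpa [rootedInc, h] using this
      · have := Submodule.add_mem _ ih hmem
        simpa [rootedInc, h] using this
  have hsurj : Function.Surjective N.vecMul := by
    intro y
    have : y ∈ LinearMap.range N.vecMulLinear := by
      rw [pi_eq_sum_univ' y]
      refine Submodule.sum_mem _ fun v _ => Submodule.smul_mem _ _ ?_
      convert hsingle v using 1
    exact this
  have hunit := (isUnit_iff_isUnit_det N).1 (vecMul_surjective_iff_isUnit.1 hsurj)
  rcases Int.isUnit_iff.1 hunit with h | h <;> simp [h]

theorem det_rootedInc_eq_zero [DecidableEq E] (ends : E → V × V) (r : V) (g : V → Option E)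
    (h : ¬ (none ∈ univ.image g ∧ EdgeConn ends (eraseNone (univ.image g)))) :
    (of fun i => rootedInc ℤ ends r (g i)).det = 0 := by
  classical
  suffices ∃ y : V → ℤ, y ≠ 0 ∧ ∀ o ∈ univ.image g, rootedInc ℤ ends r o ⬝ᵥ y = 0 by
    obtain ⟨y, hy, hzero⟩ := this
    exact exists_mulVec_eq_zero_iff.1
      ⟨y, hy, funext fun i => hzero (g i) (mem_image_of_mem g (mem_univ i))⟩
  by_cases hr : none ∈ univ.image g
  · have hc : ¬ EdgeConn ends (eraseNone (univ.image g)) := fun hc => h ⟨hr, hc⟩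
    set step : V → V → Prop := fun x y =>
      ∃ e ∈ eraseNone (univ.image g), ends e = (x, y) ∨ ends e = (y, x)
    have : Std.Symm step := ⟨fun x y ⟨e, he, h⟩ => ⟨e, he, h.symm⟩⟩
    obtain ⟨b, hb⟩ : ∃ b, ¬ Relation.ReflTransGen step r b := by
      by_contra! hall
      exact hc fun a b => (Std.Symm.symm _ _ (hall a)).trans (hall b)
    refine ⟨fun v => if Relation.ReflTransGen step r v then 0 else 1, fun h0 => ?_, ?_⟩
    · simpa [hb] using congrFun h0 b
    · rintro (_ | e) ho
      · simp [rootedInc_none_dotProduct, Relation.ReflTransGen.refl]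
      · have he : e ∈ eraseNone (univ.image g) := mem_eraseNone.2 ho
        have hiff : Relation.ReflTransGen step r (ends e).1 ↔
            Relation.ReflTransGen step r (ends e).2 :=
          ⟨fun h => h.tail ⟨e, he, Or.inl rfl⟩, fun h => h.tail ⟨e, he, Or.inr rfl⟩⟩
        simp [rootedInc_some_dotProduct, hiff]
  · refine ⟨1, fun h0 => by simpa using congrFun h0 r, ?_⟩
    rintro (_ | e) ho
    · exact absurd ho hr
    · simp [rootedInc_some_dotProduct]

variable [Fintype E]

/-- The Laplacian grounded at the root `r`. -/
noncomputable def rootedLap (ends : E → V × V) (w : E → ℝ) (r : V) : Matrix V V ℝ :=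
  lap ends w + vecMulVec (Pi.single r 1) (Pi.single r 1)

theorem rootedLap_eq_sum (ends : E → V × V) (w : E → ℝ) (r : V) :
    rootedLap ends w r = ∑ o : Option E, o.elim 1 w •
      vecMulVec (rootedInc ℝ ends r o) (rootedInc ℝ ends r o) := by
  rw [Fintype.sum_option]
  simp only [rootedInc_some, Option.elim, rootedLap, lap, one_smul]
  rw [add_comm]
  rfl

/-- The weighted matrix-tree theorem. -/
theorem det_rootedLap (ends : E → V × V) (w : E → ℝ) (r : V) :
    (rootedLap ends w r).det = treeWeight ends w univ := by
  classical
  rw [rootedLap_eq_sum, det_sum_smul_vecMulVec _ _ (fun S : Finset (Option E) =>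
    if none ∈ S ∧ IsSpanningTree ends (eraseNone S) then 1 else 0)]
  · unfold treeWeight
    symm
    refine Finset.sum_of_injOn insertNone (insertNone.injective.injOn) (by simp) ?_ ?_
    · intro S _ hS
      rw [if_neg, mul_zero]
      rintro ⟨hnone, -⟩
      exact hS ⟨eraseNone S, by simp, by rw [insertNone_eraseNone, insert_eq_of_mem hnone]⟩
    · intro T _
      simp [prod_insertNone]
  · intro g hg
    have hcast : (of fun i => rootedInc ℝ ends r (g i)) =
        (of fun i => rootedInc ℤ ends r (g i)).map (Int.castRingHom ℝ) := by
      ext i j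
      simp [intCast_rootedInc]
    rw [hcast, ← RingHom.mapMatrix_apply, ← RingHom.map_det]
    by_cases h : none ∈ univ.image g ∧ EdgeConn ends (eraseNone (univ.image g))
    · have hcard : (eraseNone (univ.image g)).card + 1 = Fintype.card V := by
        rw [← card_insertNone, insertNone_eraseNone, insert_eq_of_mem h.1,
          card_image_of_injective _ hg, card_univ]
      rw [if_pos ⟨h.1, h.2, hcard⟩, ← map_pow, det_rootedInc_sq_eq_one ends r g h.1 h.2, map_one]
    · rw [if_neg fun h' => h ⟨h'.1, h'.2.1⟩, det_rootedInc_eq_zero ends r g h]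
      simp
  · intro S hS
    refine if_neg fun h => hS ?_
    rw [← h.2.2, ← card_insertNone, insertNone_eraseNone, insert_eq_of_mem h.1]

theorem dotProduct_lap_mulVec (ends : E → V × V) (w : E → ℝ) (x y : V → ℝ) :
    x ⬝ᵥ lap ends w *ᵥ y = ∑ e, w e * ((inc ends e ⬝ᵥ x) * (inc ends e ⬝ᵥ y)) := by
  simp only [lap, sum_mulVec, dotProduct_sum, smul_mulVec, vecMulVec_mulVec, dotProduct_smul,
    smul_eq_mul, op_smul_eq_smul]
  refine Finset.sum_congr rfl fun e _ => ?_
  rw [dotProduct_comm x]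
  ring

theorem dotProduct_rootedLap_mulVec (ends : E → V × V) (w : E → ℝ) (r : V) (x y : V → ℝ) :
    x ⬝ᵥ rootedLap ends w r *ᵥ y = x ⬝ᵥ lap ends w *ᵥ y + x r * y r := by
  simp [rootedLap, add_mulVec, vecMulVec_mulVec, mul_comm]

theorem det_rootedLap_ne_zero (ends : E → V × V) (w : E → ℝ) (r : V)
    (hw : ∀ e, 0 < w e) (hconn : EdgeConn ends univ) : (rootedLap ends w r).det ≠ 0 := by
  intro hdet
  obtain ⟨x, hx, hzero⟩ := exists_mulVec_eq_zero_iff.2 hdet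
  have hq := dotProduct_rootedLap_mulVec ends w r x x
  rw [hzero, dotProduct_zero, dotProduct_lap_mulVec] at hq
  have hnonneg : ∀ e ∈ univ, 0 ≤ w e * ((inc ends e ⬝ᵥ x) * (inc ends e ⬝ᵥ x)) :=
    fun e _ => mul_nonneg (hw e).le (mul_self_nonneg _)
  have hsum := Finset.sum_nonneg hnonneg
  have hr : x r = 0 := mul_self_eq_zero.1 (by linarith [mul_self_nonneg (x r)])
  have hedge : ∀ e, x (ends e).1 = x (ends e).2 := fun e => by
    have := (Finset.sum_eq_zero_iff_of_nonneg hnonneg).1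
      (by linarith [mul_self_nonneg (x r)]) e (mem_univ e)
    rw [mul_eq_zero_iff_left (hw e).ne', mul_self_eq_zero, inc_dotProduct] at this
    linarith
  refine hx (funext fun v => ?_)
  induction hconn r v with
  | refl => exact hr
  | tail _ hstep ih =>
    obtain ⟨e, -, h | h⟩ := hstep
    · have := hedge e
      rw [h] at this
      exact this.symm.trans ih
    · have := hedge e
      rw [h] at this
      exact this.trans ih

theorem lap_transpose (ends : E → V × V) (w : E → ℝ) : (lap ends w)ᵀ = lap ends w := by
  simp [lap, transpose_sum, transpose_vecMulVec]

theorem lap_mulVec_of_rootedLap_mulVec (ends : E → V × V) (w : E → ℝ) (r : V) {x b : V → ℝ}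
    (hb : 1 ⬝ᵥ b = 0) (h : rootedLap ends w r *ᵥ x = b) : lap ends w *ᵥ x = b := by
  have hr : x r = 0 := by
    have := dotProduct_rootedLap_mulVec ends w r 1 x
    rw [h, hb, dotProduct_lap_mulVec] at this
    simpa [inc_dotProduct] using this.symm
  rw [← h, rootedLap, add_mulVec, vecMulVec_mulVec]
  simp [hr]

theorem inc_dotProduct_pinv_mulVec_inc {ends : E → V × V} {w : E → ℝ} {Ldag : Matrix V V ℝ}
    (h : lap ends w * Ldag * lap ends w = lap ends w) {r : V}
    (hdet : (rootedLap ends w r).det ≠ 0) (e : E) :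
    inc ends e ⬝ᵥ Ldag *ᵥ inc ends e =
      inc ends e ⬝ᵥ (rootedLap ends w r)⁻¹ *ᵥ inc ends e := by
  have hx := lap_mulVec_of_rootedLap_mulVec ends w r (x := (rootedLap ends w r)⁻¹ *ᵥ inc ends e)
    (b := inc ends e) (by rw [dotProduct_comm, inc_dotProduct]; simp)
    (by rw [mulVec_mulVec, mul_nonsing_inv _ hdet.isUnit, one_mulVec])
  set x := (rootedLap ends w r)⁻¹ *ᵥ inc ends e
  calc inc ends e ⬝ᵥ Ldag *ᵥ inc ends e
      = (lap ends w *ᵥ x) ⬝ᵥ Ldag *ᵥ (lap ends w *ᵥ x) := by rw [hx]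
    _ = x ⬝ᵥ (lap ends w * Ldag * lap ends w) *ᵥ x := by
        nth_rw 1 [← lap_transpose]
        rw [mulVec_transpose, ← dotProduct_mulVec]
        simp only [mulVec_mulVec, Matrix.mul_assoc]
    _ = inc ends e ⬝ᵥ x := by rw [h, hx, dotProduct_comm]

variable [DecidableEq E]

theorem rootedLap_update_zero (ends : E → V × V) (w : E → ℝ) (r : V) (e : E) :
    rootedLap ends (Function.update w e 0) r =
      rootedLap ends w r +
        replicateCol Unit (-w e • inc ends e) * replicateRow Unit (inc ends e) := by
  rw [← vecMulVec_eq, smul_vecMulVec]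
  have : lap ends w = lap ends (Function.update w e 0) +
      w e • vecMulVec (inc ends e) (inc ends e) := by
    simp only [lap, ← Finset.add_sum_erase univ _ (mem_univ e), Function.update_self, zero_smul,
      zero_add]
    rw [add_comm]
    congr 1
    refine Finset.sum_congr rfl fun e' he' => ?_
    rw [Function.update_of_ne (ne_of_mem_erase he')]
  rw [rootedLap, rootedLap, this, neg_smul]
  abel

end MatrixTree

/-- For a connected weighted graph `G` and an edge `e₀`,
`1 - 𝒯(G ∖ {e₀}) / 𝒯(G) = w_{e₀} ⬝ b(e₀)ᵀ L† b(e₀)`: the leverage score of `e₀`. -/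
theorem leverage_score_eq_tree_ratio {V E : Type*} [Fintype V] [Fintype E] [DecidableEq V]
    [DecidableEq E] [Nonempty V]
    (ends : E → V × V) (w : E → ℝ) (Ldag : Matrix V V ℝ) (e₀ : E)
    (hw : ∀ e, 0 < w e) (hconn : EdgeConn ends univ)
    (h1 : lap ends w * Ldag * lap ends w = lap ends w)
    (h2 : Ldag * lap ends w * Ldag = Ldag)
    (h3 : (lap ends w * Ldag)ᵀ = lap ends w * Ldag)
    (h4 : (Ldag * lap ends w)ᵀ = Ldag * lap ends w) :
    1 - treeWeight ends w (univ.erase e₀) / treeWeight ends w univ =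
      w e₀ * (inc ends e₀ ⬝ᵥ Ldag *ᵥ inc ends e₀) := by
  obtain ⟨r⟩ := ‹Nonempty V›
  have hdet := det_rootedLap_ne_zero ends w r hw hconn
  have hratio := congrArg Matrix.det (rootedLap_update_zero ends w r e₀)
  rw [det_add_replicateCol_mul_replicateRow hdet.isUnit, det_rootedLap, treeWeight_update_zero,
    det_rootedLap] at hratio
  rw [det_rootedLap] at hdet
  rw [hratio, mul_div_cancel_left₀ _ hdet,
    inc_dotProduct_pinv_mulVec_inc h1 (r := r) (by rwa [det_rootedLap])]
  rw [det_unique, Matrix.add_apply, Matrix.mul_assoc, ← replicateCol_mulVec,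
    replicateRow_mul_replicateCol_apply, mulVec_smul, dotProduct_smul]
  simp
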